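/- Let (α,ε) be an r-colored composition of n with rainbow decomposition (α_{(1)},ε_{(1)})⋯(α_{(m)},ε_{(m)}). Then an r-colored composition (β,δ) of n satisfies (β,δ) ⪯ (α,ε) in the reverse refinement order on colored compositions if and only if (β,δ) is the concatenation (β_{(1)},ε_{(1)})⋯(β_{(m)},ε_{(m)}) of monochromatic colored compositions with β_{(i)} ⪯ α_{(i)} in the reverse refinement order on ordinary compositions for all 1 ≤ i ≤ m; moreover in that case ℓ(β) = ℓ(β_{(1)}) + ⋯ + ℓ(β_{(m)}). -/

import Mathlib

/-- The rainbow decomposition of a colored list: the unique way of grouping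
adjacent entries of equal color into maximal monochromatic blocks.  Each block
is recorded as (list of first components, common color). -/
def rainbow {r : ℕ} : List (ℕ × Fin r) → List (List ℕ × Fin r)
  | [] => []
  | (a, c) :: rest =>
    match rainbow rest with
    | [] => [([a], c)]
    | (b, c') :: bs =>
        if c = c' then (a :: b, c') :: bs else ([a], c) :: (b, c') :: bs
/-- The extended color vector of a colored composition: each color is repeated
as many times as the size of its part. -/
def colorWord {r : ℕ} (l : List (ℕ × Fin r)) : List (Fin r) :=
  (l.map fun p => List.replicate p.1 p.2).flatten

/-- Poirier's colored fundamental quasisymmetric function `F^{(r)}_{(α,ε)}`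
associated with the colored composition `l` of `n`, in the `r` sets of
variables `x^{(j)}_i` indexed by `Fin r × ℕ`: the sum over all weakly
increasing `i₁ ≤ … ≤ i_n` which increase strictly at every partial sum
`r_j = α₁ + … + α_j` with `ε_j ≥ ε_{j+1}`, of
`x^{(ε̃₁)}_{i_1} ⋯ x^{(ε̃_n)}_{i_n}` where `ε̃` is the extended color
vector. -/
noncomputable def Fcol {r : ℕ} [NeZero r] (n : ℕ) (l : List (ℕ × Fin r)) :
    MvPowerSeries (Fin r × ℕ) ℤ := fun d =>
  (({i : Fin n → ℕ |
      Monotone i ∧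
      (∀ k, k + 1 < l.length → (l.getD (k + 1) (1, 0)).2 ≤ (l.getD k (1, 0)).2 →
        ∀ (h1 : 1 ≤ ((l.take (k + 1)).map Prod.fst).sum)
          (h2 : ((l.take (k + 1)).map Prod.fst).sum < n),
          i ⟨((l.take (k + 1)).map Prod.fst).sum - 1, by omega⟩ <
            i ⟨((l.take (k + 1)).map Prod.fst).sum, h2⟩) ∧
      (∑ t : Fin n, Finsupp.single ((colorWord l).getD (t : ℕ) 0, i t) 1) = d}).ncard : ℤ)
/-- The set of partial sums of a colored composition, excluding the total sum
(the colored subset of `[n-1]` corresponding to `l`, forgetting colors). -/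
def cInnerSums {r : ℕ} (l : List (ℕ × Fin r)) : Set ℕ :=
  {m | ∃ k, k + 1 < l.length ∧ m = ((l.take (k + 1)).map Prod.fst).sum}

/-- The reverse refinement order on `r`-colored compositions, in which only
consecutive parts of equal color may be merged: `b ⪯ a` iff `a` and `b` have
the same extended color vector and the partial-sum set of `b` is contained in
that of `a`. -/
def coarserC {r : ℕ} (b a : List (ℕ × Fin r)) : Prop :=
  colorWord b = colorWord a ∧ cInnerSums b ⊆ cInnerSums a

/-- The set of partial sums of a list of naturals, excluding the total sum. -/
def innerSumsL (l : List ℕ) : Set ℕ :=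
  {m | ∃ k, k + 1 < l.length ∧ m = (l.take (k + 1)).sum}

/-- The reverse refinement order on ordinary compositions (given as lists of
parts): `b ⪯ a` iff they have the same sum and `S_b ⊆ S_a`. -/
def listCoarser (b a : List ℕ) : Prop :=
  b.sum = a.sum ∧ innerSumsL b ⊆ innerSumsL a

/-- The set of all partial sums of a list, including `0` and the total sum. -/
def prefixSums (l : List ℕ) : Set ℕ :=
  {m | ∃ x y, l = x ++ y ∧ m = x.sum}

lemma zero_mem_prefixSums (l : List ℕ) : 0 ∈ prefixSums l := ⟨[], l, rfl, rfl⟩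

lemma sum_mem_prefixSums (l : List ℕ) : l.sum ∈ prefixSums l := ⟨l, [], by simp, rfl⟩

lemma le_sum_of_mem_prefixSums {l : List ℕ} {m : ℕ} (h : m ∈ prefixSums l) : m ≤ l.sum := by
  obtain ⟨x, y, rfl, rfl⟩ := h
  simp

lemma mem_prefixSums_append {s t : List ℕ} {m : ℕ} :
    m ∈ prefixSums (s ++ t) ↔ m ∈ prefixSums s ∨ ∃ k ∈ prefixSums t, m = s.sum + k := by
  constructor
  · rintro ⟨x, y, h, rfl⟩
    rcases List.append_eq_append_iff.1 h with ⟨z, rfl, rfl⟩ | ⟨z, rfl, rfl⟩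
    · exact Or.inr ⟨z.sum, ⟨z, y, rfl, rfl⟩, by simp⟩
    · exact Or.inl ⟨x, z, rfl, rfl⟩
  · rintro (⟨x, y, rfl, rfl⟩ | ⟨_, ⟨x, y, rfl, rfl⟩, rfl⟩)
    · exact ⟨x, y ++ t, by simp, rfl⟩
    · exact ⟨s ++ x, y, by simp, by simp⟩

lemma prefixSums_append_subset_iff {s s' t t' : List ℕ} (h : s.sum = s'.sum) :
    prefixSums (s ++ t) ⊆ prefixSums (s' ++ t') ↔
      prefixSums s ⊆ prefixSums s' ∧ prefixSums t ⊆ prefixSums t' := by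
  constructor
  · intro H
    constructor
    · intro m hm
      rcases mem_prefixSums_append.1 (H (mem_prefixSums_append.2 (Or.inl hm))) with h1 | ⟨k, -, hk⟩
      · exact h1
      · have := le_sum_of_mem_prefixSums hm
        obtain rfl : m = s'.sum := by omega
        exact sum_mem_prefixSums s'
    · intro m hm
      rcases mem_prefixSums_append.1 (H (mem_prefixSums_append.2 (Or.inr ⟨m, hm, rfl⟩)))
        with h1 | ⟨k, hk, hmk⟩
      · have := le_sum_of_mem_prefixSums h1
        obtain rfl : m = 0 := by omega
        exact zero_mem_prefixSums t'
      · obtain rfl : m = k := by omega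
        exact hk
  · rintro ⟨h1, h2⟩ m hm
    rcases mem_prefixSums_append.1 hm with hm | ⟨k, hk, rfl⟩
    · exact mem_prefixSums_append.2 (Or.inl (h1 hm))
    · exact mem_prefixSums_append.2 (Or.inr ⟨k, h2 hk, by rw [h]⟩)

lemma mem_innerSumsL_iff {l : List ℕ} (hl : ∀ a ∈ l, 0 < a) {m : ℕ} :
    m ∈ innerSumsL l ↔ m ∈ prefixSums l ∧ 0 < m ∧ m < l.sum := by
  constructor
  · rintro ⟨k, hk, rfl⟩
    refine ⟨⟨l.take (k + 1), l.drop (k + 1), by simp, rfl⟩, ?_, ?_⟩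
    · refine List.sum_pos _ (fun a ha => hl a (List.mem_of_mem_take ha)) ?_
      apply List.ne_nil_of_length_pos
      rw [List.length_take]
      omega
    · have h : 0 < (l.drop (k + 1)).sum := by
        refine List.sum_pos _ (fun a ha => hl a (List.mem_of_mem_drop ha)) ?_
        apply List.ne_nil_of_length_pos
        rw [List.length_drop]
        omega
      have := List.sum_take_add_sum_drop l (k + 1)
      omega
  · rintro ⟨⟨x, y, rfl, rfl⟩, h0, h1⟩
    have hx : x ≠ [] := by rintro rfl; simp at h0
    have hy : y ≠ [] := by rintro rfl; simp at h1
    have hx' := List.length_pos_of_ne_nil hx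
    have hy' := List.length_pos_of_ne_nil hy
    refine ⟨x.length - 1, by rw [List.length_append]; omega, ?_⟩
    rw [Nat.sub_add_cancel hx', List.take_left]

lemma innerSumsL_subset_iff {s t : List ℕ} (hs : ∀ a ∈ s, 0 < a) (ht : ∀ a ∈ t, 0 < a)
    (h : s.sum = t.sum) :
    innerSumsL s ⊆ innerSumsL t ↔ prefixSums s ⊆ prefixSums t := by
  constructor
  · intro H m hm
    have hle := le_sum_of_mem_prefixSums hm
    rcases Nat.eq_zero_or_pos m with rfl | h0
    · exact zero_mem_prefixSums t
    rcases hle.eq_or_lt with rfl | h1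
    · rw [h]
      exact sum_mem_prefixSums t
    · exact ((mem_innerSumsL_iff ht).1 (H ((mem_innerSumsL_iff hs).2 ⟨hm, h0, h1⟩))).1
  · intro H m hm
    obtain ⟨h1, h2, h3⟩ := (mem_innerSumsL_iff hs).1 hm
    exact (mem_innerSumsL_iff ht).2 ⟨H h1, h2, h ▸ h3⟩

lemma listCoarser_iff {s t : List ℕ} (hs : ∀ a ∈ s, 0 < a) (ht : ∀ a ∈ t, 0 < a) :
    listCoarser s t ↔ s.sum = t.sum ∧ prefixSums s ⊆ prefixSums t :=
  and_congr_right fun h => innerSumsL_subset_iff hs ht h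

section Colored

variable {r : ℕ}

lemma cInnerSums_eq (l : List (ℕ × Fin r)) : cInnerSums l = innerSumsL (l.map Prod.fst) := by
  simp [cInnerSums, innerSumsL, List.map_take]

lemma colorWord_cons (a : ℕ) (c : Fin r) (l : List (ℕ × Fin r)) :
    colorWord ((a, c) :: l) = List.replicate a c ++ colorWord l := rfl

lemma colorWord_append (l l' : List (ℕ × Fin r)) :
    colorWord (l ++ l') = colorWord l ++ colorWord l' := by
  simp [colorWord]

lemma colorWord_mono (s : List ℕ) (c : Fin r) :
    colorWord (s.map fun a => (a, c)) = List.replicate s.sum c := by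
  induction s with
  | nil => rfl
  | cons a s ih =>
    rw [List.map_cons, colorWord_cons, ih, List.sum_cons, List.replicate_add]

lemma map_fst_mono (s : List ℕ) (c : Fin r) :
    (s.map fun a => (a, c)).map Prod.fst = s := by
  simp [Function.comp_def]

lemma coarserC_iff {b l : List (ℕ × Fin r)} (hb : ∀ p ∈ b, 0 < p.1) (hl : ∀ p ∈ l, 0 < p.1)
    (h : (b.map Prod.fst).sum = (l.map Prod.fst).sum) :
    coarserC b l ↔
      colorWord b = colorWord l ∧ prefixSums (b.map Prod.fst) ⊆ prefixSums (l.map Prod.fst) := by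
  unfold coarserC
  rw [cInnerSums_eq, cInnerSums_eq, innerSumsL_subset_iff _ _ h]
  · intro a ha
    obtain ⟨p, hp, rfl⟩ := List.mem_map.1 ha
    exact hb p hp
  · intro a ha
    obtain ⟨p, hp, rfl⟩ := List.mem_map.1 ha
    exact hl p hp

/-- A maximal run of one color at the start of the color word of `b` is the color word of an
initial segment of `b`. -/
lemma exists_mono_prefix {c : Fin r} {w : List (Fin r)} (hw : w.head? ≠ some c)
    {b : List (ℕ × Fin r)} (hb : ∀ p ∈ b, 0 < p.1) {k : ℕ}
    (h : colorWord b = List.replicate k c ++ w) :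
    ∃ (t : List ℕ) (b' : List (ℕ × Fin r)),
      b = (t.map fun a => (a, c)) ++ b' ∧ t.sum = k ∧ colorWord b' = w := by
  induction b generalizing k with
  | nil =>
    have h' := List.append_eq_nil_iff.1 h.symm
    rw [List.replicate_eq_nil_iff] at h'
    exact ⟨[], [], rfl, by simp [h'.1], h'.2.symm⟩
  | cons p b ih =>
    obtain ⟨a, d⟩ := p
    rcases Nat.eq_zero_or_pos k with rfl | hk
    · exact ⟨[], _, rfl, rfl, by simpa using h⟩
    have ha : 0 < a := hb (a, d) (by simp)
    obtain rfl : d = c := by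
      obtain ⟨a, rfl⟩ := Nat.exists_eq_add_of_lt ha
      obtain ⟨k, rfl⟩ := Nat.exists_eq_add_of_lt hk
      simp only [colorWord_cons, List.replicate_succ, List.cons_append] at h
      exact (List.cons.inj h).1
    rw [colorWord_cons] at h
    rcases le_or_gt a k with hak | hak
    · obtain ⟨j, rfl⟩ := Nat.exists_eq_add_of_le hak
      rw [List.replicate_add, List.append_assoc] at h
      obtain ⟨t, b', rfl, rfl, hb'⟩ :=
        ih (fun p hp => hb p (List.mem_cons_of_mem _ hp)) (List.append_cancel_left h)
      exact ⟨a :: t, b', rfl, by simp, hb'⟩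
    · obtain ⟨j, rfl⟩ := Nat.exists_eq_add_of_lt hak
      rw [add_assoc, List.replicate_add, List.append_assoc] at h
      rw [← List.append_cancel_left h, List.replicate_succ] at hw
      simp at hw

/-- The concatenation of a list of monochromatic blocks. -/
def expandBlocks (B : List (List ℕ × Fin r)) : List (ℕ × Fin r) :=
  (B.map fun p => p.1.map fun a => (a, p.2)).flatten

lemma expandBlocks_cons (s : List ℕ) (c : Fin r) (B : List (List ℕ × Fin r)) :
    expandBlocks ((s, c) :: B) = (s.map fun a => (a, c)) ++ expandBlocks B := rfl

lemma rainbow_spec (l : List (ℕ × Fin r)) :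
    expandBlocks (rainbow l) = l ∧ (∀ p ∈ rainbow l, p.1 ≠ []) ∧
      (rainbow l).IsChain (fun p q => p.2 ≠ q.2) := by
  induction l with
  | nil => simp [rainbow, expandBlocks]
  | cons p l ih =>
    obtain ⟨a, c⟩ := p
    obtain ⟨h1, h2, h3⟩ := ih
    rw [rainbow]
    cases hB : rainbow l with
    | nil =>
      rw [hB] at h1
      simp [← h1, expandBlocks]
    | cons q B =>
      obtain ⟨s, d⟩ := q
      rw [hB] at h1 h2 h3
      by_cases hcd : c = d
      · subst hcd
        refine ⟨?_, ?_, ?_⟩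
        · simp [← h1, expandBlocks]
        · simp only [if_true, List.mem_cons, forall_eq_or_imp] at h2 ⊢
          exact ⟨by simp, h2.2⟩
        · simp only [if_true]
          rw [List.isChain_cons] at h3 ⊢
          exact h3
      · simp only [if_neg hcd]
        refine ⟨?_, ?_, ?_⟩
        · simp [← h1, expandBlocks]
        · rw [List.forall_mem_cons]
          exact ⟨by simp, h2⟩
        · exact List.isChain_cons_cons.2 ⟨hcd, h3⟩

lemma pos_of_mem_block {B : List (List ℕ × Fin r)} (h : ∀ p ∈ expandBlocks B, 0 < p.1) :
    ∀ p ∈ B, ∀ a ∈ p.1, 0 < a := by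
  intro p hp a ha
  refine h (a, p.2) ?_
  rw [expandBlocks, List.mem_flatten]
  exact ⟨_, List.mem_map_of_mem hp, List.mem_map_of_mem ha⟩

lemma head?_colorWord_expandBlocks_ne {s : List ℕ} {c : Fin r} {B : List (List ℕ × Fin r)}
    (hne : ∀ p ∈ B, p.1 ≠ []) (hpos : ∀ p ∈ B, ∀ a ∈ p.1, 0 < a)
    (hchain : ((s, c) :: B).IsChain (fun p q => p.2 ≠ q.2)) :
    (colorWord (expandBlocks B)).head? ≠ some c := by
  cases B with
  | nil => simp [expandBlocks, colorWord]
  | cons q B =>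
    obtain ⟨t, d⟩ := q
    have hcd : c ≠ d := (List.isChain_cons_cons.1 hchain).1
    have ht : 0 < t.sum :=
      List.sum_pos _ (hpos (t, d) (by simp)) (hne (t, d) (by simp))
    obtain ⟨k, hk⟩ := Nat.exists_eq_add_of_lt ht
    rw [expandBlocks_cons, colorWord_append, colorWord_mono, hk, List.replicate_succ]
    simpa using hcd.symm

lemma coarser_expandBlocks_iff {B : List (List ℕ × Fin r)} (hne : ∀ p ∈ B, p.1 ≠ [])
    (hpos : ∀ p ∈ B, ∀ a ∈ p.1, 0 < a) (hchain : B.IsChain (fun p q => p.2 ≠ q.2))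
    {b : List (ℕ × Fin r)} (hb : ∀ p ∈ b, 0 < p.1) :
    (colorWord b = colorWord (expandBlocks B) ∧
        prefixSums (b.map Prod.fst) ⊆ prefixSums ((expandBlocks B).map Prod.fst)) ↔
      ∃ bs : List (List ℕ),
        List.Forall₂ (fun s p => s ≠ [] ∧ (∀ a ∈ s, 0 < a) ∧ listCoarser s p.1) bs B ∧
        b = ((bs.zip B).map fun q => q.1.map fun a => (a, q.2.2)).flatten := by
  induction B generalizing b with
  | nil =>
    constructor
    · rintro ⟨h, -⟩
      refine ⟨[], List.Forall₂.nil, ?_⟩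
      cases b with
      | nil => rfl
      | cons p b =>
        have hp := hb p (by simp)
        obtain ⟨a, c⟩ := p
        have h' := (List.append_eq_nil_iff.1 h).1
        rw [List.replicate_eq_nil_iff] at h'
        exact absurd h' hp.ne'
    · rintro ⟨bs, -, rfl⟩
      simp [expandBlocks]
  | cons q B ih =>
    obtain ⟨s, c⟩ := q
    have hs := hpos (s, c) (by simp)
    have hs' := hne (s, c) (by simp)
    rw [List.forall_mem_cons] at hne hpos
    specialize @ih hne.2 hpos.2 hchain.tail
    rw [expandBlocks_cons, colorWord_append, colorWord_mono, List.map_append, map_fst_mono]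
    constructor
    · rintro ⟨h1, h2⟩
      obtain ⟨t, b', rfl, hsum, hb'⟩ := exists_mono_prefix
        (head?_colorWord_expandBlocks_ne hne.2 hpos.2 hchain) hb h1
      rw [List.map_append, map_fst_mono, prefixSums_append_subset_iff hsum] at h2
      obtain ⟨bs, hbs, rfl⟩ :=
        (ih fun p hp => hb p (List.mem_append_right _ hp)).1 ⟨hb', h2.2⟩
      have ht : ∀ a ∈ t, 0 < a := fun a ha =>
        hb (a, c) (List.mem_append_left _ (List.mem_map_of_mem ha))
      have ht' : t ≠ [] := by
        rintro rfl
        exact (List.sum_pos _ hs hs').ne hsum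
      exact ⟨t :: bs, List.Forall₂.cons ⟨ht', ht, (listCoarser_iff ht hs).2 ⟨hsum, h2.1⟩⟩ hbs, rfl⟩
    · rintro ⟨_, hbs, rfl⟩
      obtain ⟨t, bs, ⟨-, ht, htc⟩, hbs', rfl⟩ := List.forall₂_cons_right_iff.1 hbs
      rw [listCoarser_iff ht hs] at htc
      rw [List.zip_cons_cons, List.map_cons, List.flatten_cons] at hb ⊢
      obtain ⟨h1, h2⟩ := (ih fun p hp => hb p (List.mem_append_right _ hp)).2 ⟨bs, hbs', rfl⟩
      rw [colorWord_append, colorWord_mono, h1, htc.1, List.map_append, map_fst_mono,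
        prefixSums_append_subset_iff htc.1]
      exact ⟨rfl, htc.2, h2⟩

lemma length_flatten_zip {B : List (List ℕ × Fin r)} {bs : List (List ℕ)}
    (h : bs.length = B.length) :
    ((bs.zip B).map fun q => q.1.map fun a => (a, q.2.2)).flatten.length =
      (bs.map List.length).sum := by
  induction bs generalizing B with
  | nil => rfl
  | cons t bs ih =>
    cases B with
    | nil => simp at h
    | cons q B =>
      rw [List.zip_cons_cons, List.map_cons, List.flatten_cons, List.length_append,
        ih (Nat.succ.inj h), List.length_map, List.map_cons, List.sum_cons]

end Colored

/-- Let `(α,ε)` be an `r`-colored composition of `n` (the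
list `l`) with rainbow decomposition `(α_{(1)},ε_{(1)}) ⋯ (α_{(m)},ε_{(m)})`.
An `r`-colored composition `(β,δ)` of `n` (the list `b`) satisfies
`(β,δ) ⪯ (α,ε)` in the reverse refinement order on colored compositions if and
only if `b` is a concatenation `(β_{(1)},ε_{(1)}) ⋯ (β_{(m)},ε_{(m)})` of
monochromatic colored compositions with `β_{(i)} ⪯ α_{(i)}` in the reverse
refinement order on ordinary compositions for all `i`; moreover, in that case
`ℓ(β) = ℓ(β_{(1)}) + ⋯ + ℓ(β_{(m)})`. -/
theorem statement15 (n r : ℕ) (hn : 0 < n) (l : List (ℕ × Fin r))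
    (hpos : ∀ p ∈ l, 0 < p.1) (hsum : (l.map Prod.fst).sum = n)
    (b : List (ℕ × Fin r)) (hbpos : ∀ p ∈ b, 0 < p.1)
    (hbsum : (b.map Prod.fst).sum = n) :
    (coarserC b l ↔
      ∃ bs : List (List ℕ),
        List.Forall₂
          (fun s p => s ≠ [] ∧ (∀ a ∈ s, 0 < a) ∧ listCoarser s p.1)
          bs (rainbow l) ∧
        b = ((bs.zip (rainbow l)).map fun q =>
              q.1.map fun a => (a, q.2.2)).flatten) ∧
    ∀ bs : List (List ℕ),
      List.Forall₂
          (fun s p => s ≠ [] ∧ (∀ a ∈ s, 0 < a) ∧ listCoarser s p.1)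
          bs (rainbow l) →
      b = ((bs.zip (rainbow l)).map fun q => q.1.map fun a => (a, q.2.2)).flatten →
      b.length = (bs.map List.length).sum := by
  obtain ⟨hexp, hne, hchain⟩ := rainbow_spec l
  have hpos' : ∀ p ∈ rainbow l, ∀ a ∈ p.1, 0 < a := pos_of_mem_block (hexp.symm ▸ hpos)
  constructor
  · rw [coarserC_iff hbpos hpos (hbsum.trans hsum.symm),
      ← coarser_expandBlocks_iff hne hpos' hchain hbpos, hexp]
  · rintro bs hbs rfl
    exact length_flatten_zip hbs.length_eq
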